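/- Let (X, Y) be bivariate Gaussian with mean zero, variances Σ₁₁, Σ₂₂ and correlation ρ = Σ₁₂/√(Σ₁₁Σ₂₂). Then E[max(0,X)·max(0,Y)] = (1/(2π)) √(Σ₁₁Σ₂₂) · (√(1-ρ²) + (π/2 + arcsin ρ)·ρ). -/

import Mathlib

open MeasureTheory ProbabilityTheory

/-- The **Cramér–Wold theorem** in the plane. -/
lemma ext_of_map_linear_combination {μ ν : Measure (ℝ × ℝ)} [IsFiniteMeasure μ]
    [IsFiniteMeasure ν]
    (h : ∀ a b : ℝ, μ.map (fun p => a * p.1 + b * p.2) = ν.map (fun p => a * p.1 + b * p.2)) :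
    μ = ν := by
  refine Measure.ext_of_charFunDual (funext fun L => ?_)
  have hL : (L : ℝ × ℝ → ℝ) = fun p => L (1, 0) * p.1 + L (0, 1) * p.2 := by
    funext p
    have hp : p = p.1 • ((1 : ℝ), (0 : ℝ)) + p.2 • ((0 : ℝ), (1 : ℝ)) := by ext <;> simp
    conv_lhs => rw [hp, map_add, map_smul, map_smul]
    simp [mul_comm]
  rw [charFunDual_eq_charFun_map_one, charFunDual_eq_charFun_map_one, hL, h]

lemma map_linear_combination_stdGaussian_prod (a b : ℝ) :
    ((gaussianReal 0 1).prod (gaussianReal 0 1)).map (fun p => a * p.1 + b * p.2) =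
      gaussianReal 0 (Real.toNNReal (a ^ 2 + b ^ 2)) := by
  have hmap (c : ℝ) : (gaussianReal 0 1).map (c * ·) = gaussianReal 0 (Real.toNNReal (c ^ 2)) := by
    rw [gaussianReal_map_const_mul, mul_zero, mul_one]
    congr 1
    ext
    simp [sq_nonneg]
  have hind : IndepFun (fun p : ℝ × ℝ => a * p.1) (fun p : ℝ × ℝ => b * p.2)
      ((gaussianReal 0 1).prod (gaussianReal 0 1)) :=
    indepFun_prod (X := (a * ·)) (Y := (b * ·)) (by fun_prop) (by fun_prop)
  have h₁ : ((gaussianReal 0 1).prod (gaussianReal 0 1)).map (fun p : ℝ × ℝ => a * p.1) =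
      gaussianReal 0 (Real.toNNReal (a ^ 2)) := by
    rw [← hmap, ← Function.comp_def (a * ·) Prod.fst,
      ← Measure.map_map (by fun_prop) measurable_fst, Measure.map_fst_prod]
    simp
  have h₂ : ((gaussianReal 0 1).prod (gaussianReal 0 1)).map (fun p : ℝ × ℝ => b * p.2) =
      gaussianReal 0 (Real.toNNReal (b ^ 2)) := by
    rw [← hmap, ← Function.comp_def (b * ·) Prod.snd,
      ← Measure.map_map (by fun_prop) measurable_snd, Measure.map_snd_prod]
    simp
  have h := gaussianReal_add_gaussianReal_of_indepFun hind h₁ h₂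
  rwa [add_zero, ← Real.toNNReal_add (sq_nonneg a) (sq_nonneg b)] at h

lemma integral_stdGaussian_prod_eq_polar (f : ℝ × ℝ → ℝ) :
    ∫ p, f p ∂((gaussianReal 0 1).prod (gaussianReal 0 1)) =
      ∫ q in Set.Ioi (0 : ℝ) ×ˢ Set.Ioo (-Real.pi) Real.pi,
        q.1 * ((2 * Real.pi)⁻¹ * Real.exp (-(1 / 2) * q.1 ^ (2 : ℝ)) *
          f (q.1 * Real.cos q.2, q.1 * Real.sin q.2)) := by
  have hdens (x y : ℝ) : (gaussianPDF 0 1 x * gaussianPDF 0 1 y).toReal =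
      (2 * Real.pi)⁻¹ * Real.exp (-(1 / 2) * (x ^ 2 + y ^ 2)) := by
    rw [ENNReal.toReal_mul, toReal_gaussianPDF, toReal_gaussianPDF, gaussianPDFReal_def]
    have hsq : √(2 * Real.pi) * √(2 * Real.pi) = 2 * Real.pi :=
      Real.mul_self_sqrt (by positivity)
    rw [← hsq, mul_inv, show -(1 / 2) * (x ^ 2 + y ^ 2) = -(x - 0) ^ 2 / 2 + -(y - 0) ^ 2 / 2 by
      ring, Real.exp_add]
    simp
    ring
  rw [gaussianReal_of_var_ne_zero 0 one_ne_zero,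
    prod_withDensity (measurable_gaussianPDF 0 1) (measurable_gaussianPDF 0 1),
    integral_withDensity_eq_integral_toReal_smul (by fun_prop)
      (.of_forall fun _ => ENNReal.mul_lt_top gaussianPDF_lt_top gaussianPDF_lt_top),
    ← Measure.volume_eq_prod, ← integral_comp_polarCoord_symm]
  refine setIntegral_congr_fun (measurableSet_Ioi.prod measurableSet_Ioo) fun q _ => ?_
  simp only [polarCoord_symm_apply, hdens, smul_eq_mul, Real.rpow_two]
  rw [show (q.1 * Real.cos q.2) ^ 2 + (q.1 * Real.sin q.2) ^ 2 = q.1 ^ 2 by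
    rw [mul_pow, mul_pow, ← mul_add, Real.cos_sq_add_sin_sq, mul_one]]

lemma integral_max_cos_mul_max_sin_add {θ : ℝ} (h₁ : -(Real.pi / 2) ≤ θ) (h₂ : θ ≤ Real.pi / 2) :
    ∫ φ in Set.Ioo (-Real.pi) Real.pi, max 0 (Real.cos φ) * max 0 (Real.sin (θ + φ)) =
      (Real.cos θ + (Real.pi / 2 + θ) * Real.sin θ) / 2 := by
  have hpi := Real.pi_pos
  have hzero : ∀ φ ∈ Set.Ioo (-Real.pi) Real.pi \ Set.Ioc (-θ) (Real.pi / 2),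
      max 0 (Real.cos φ) * max 0 (Real.sin (θ + φ)) = 0 := by
    rintro φ ⟨⟨hl, hu⟩, hn⟩
    by_cases hc : Real.cos φ ≤ 0
    · simp [max_eq_left hc]
    have hφ : φ ≤ Real.pi / 2 := by
      by_contra! h
      exact hc (Real.cos_nonpos_of_pi_div_two_le_of_le h.le (by linarith))
    have hφ' : -(Real.pi / 2) ≤ φ := by
      by_contra! h
      refine hc ?_
      rw [← Real.cos_neg]
      exact Real.cos_nonpos_of_pi_div_two_le_of_le (by linarith) (by linarith)
    have hθ : φ ≤ -θ := by
      by_contra! h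
      exact hn ⟨h, hφ⟩
    rw [max_eq_left (Real.sin_nonpos_of_nonpos_of_neg_pi_le (by linarith) (by linarith)), mul_zero]
  have hderiv (φ : ℝ) : HasDerivAt
      (fun φ => (-Real.cos (2 * φ + θ) / 2 + φ * Real.sin θ) / 2)
      (Real.cos φ * Real.sin (θ + φ)) φ := by
    have h : HasDerivAt (fun φ => 2 * φ + θ) 2 φ := by
      simpa using ((hasDerivAt_id φ).const_mul 2).add_const θ
    refine ((((h.cos.neg).div_const 2).add
      ((hasDerivAt_id φ).mul_const (Real.sin θ))).div_const 2).congr_deriv ?_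
    rw [show 2 * φ + θ = (θ + φ) + φ by ring]
    nth_rewrite 2 [show θ = (θ + φ) - φ by ring]
    rw [Real.sin_add, Real.sin_sub]
    ring
  have hsub : Set.Ioc (-θ) (Real.pi / 2) ⊆ Set.Ioo (-Real.pi) Real.pi := fun φ hφ =>
    ⟨by linarith [hφ.1], by linarith [hφ.2]⟩
  rw [setIntegral_eq_of_subset_of_forall_sdiff_eq_zero measurableSet_Ioo hsub hzero,
    setIntegral_congr_fun (g := fun φ => Real.cos φ * Real.sin (θ + φ)) measurableSet_Ioc,
    ← intervalIntegral.integral_of_le (by linarith),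
    intervalIntegral.integral_eq_sub_of_hasDerivAt (fun φ _ => hderiv φ)
      (Continuous.intervalIntegrable (by fun_prop) _ _)]
  · rw [show 2 * (Real.pi / 2) + θ = θ + Real.pi by ring, Real.cos_add_pi,
      show 2 * -θ + θ = -θ by ring, Real.cos_neg]
    ring
  · intro φ hφ
    simp only
    rw [max_eq_right (Real.cos_nonneg_of_neg_pi_div_two_le_of_le (by linarith [hφ.1]) hφ.2),
      max_eq_right (Real.sin_nonneg_of_nonneg_of_le_pi (by linarith [hφ.1]) (by linarith [hφ.2]))]

/-- The first-order **arc-cosine kernel** of two standard Gaussians with correlation `sin θ`. -/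
lemma integral_max_mul_max_stdGaussian_prod {θ : ℝ} (h₁ : -(Real.pi / 2) ≤ θ)
    (h₂ : θ ≤ Real.pi / 2) :
    ∫ p, max 0 p.1 * max 0 (Real.sin θ * p.1 + Real.cos θ * p.2)
        ∂((gaussianReal 0 1).prod (gaussianReal 0 1)) =
      1 / (2 * Real.pi) * (Real.cos θ + (Real.pi / 2 + θ) * Real.sin θ) := by
  have hradial : ∫ r in Set.Ioi (0 : ℝ), r ^ (3 : ℝ) * Real.exp (-(1 / 2) * r ^ (2 : ℝ)) = 2 := by
    rw [integral_rpow_mul_exp_neg_mul_rpow (by norm_num) (by norm_num) (by norm_num),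
      show ((3 : ℝ) + 1) / 2 = 1 + 1 by norm_num, Real.Gamma_add_one one_ne_zero, Real.Gamma_one,
      show -((3 : ℝ) + 1) / 2 = (-2 : ℤ) by norm_num, Real.rpow_intCast]
    norm_num
  rw [integral_stdGaussian_prod_eq_polar,
    setIntegral_congr_fun
      (g := fun q => ((2 * Real.pi)⁻¹ * (q.1 ^ (3 : ℝ) * Real.exp (-(1 / 2) * q.1 ^ (2 : ℝ)))) * (max 0 (Real.cos q.2) * max 0 (Real.sin (θ + q.2))))
      (measurableSet_Ioi.prod measurableSet_Ioo), Measure.volume_eq_prod,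
    setIntegral_prod_mul
      (fun r : ℝ => (2 * Real.pi)⁻¹ * (r ^ (3 : ℝ) * Real.exp (-(1 / 2) * r ^ (2 : ℝ))))
      (fun φ => max 0 (Real.cos φ) * max 0 (Real.sin (θ + φ))),
    integral_const_mul, hradial, integral_max_cos_mul_max_sin_add h₁ h₂]
  · field_simp
  · intro q hq
    have hr : 0 ≤ q.1 := le_of_lt hq.1
    have hmax (x : ℝ) : max 0 (q.1 * x) = q.1 * max 0 x := by
      rw [mul_max_of_nonneg _ _ hr, mul_zero]
    have hsin : Real.sin θ * (q.1 * Real.cos q.2) + Real.cos θ * (q.1 * Real.sin q.2) =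
        q.1 * Real.sin (θ + q.2) := by
      rw [Real.sin_add]
      ring
    have hpow : q.1 ^ (3 : ℝ) = q.1 ^ 3 := by exact_mod_cast Real.rpow_natCast q.1 3
    simp only [hsin, hmax, hpow]
    ring

/-- For a centred bivariate Gaussian `(X,Y)` with variances `S11, S22` and
correlation `ρ = S12 / √(S11 S22)`,
`E[max 0 X · max 0 Y] = (1/(2π)) √(S11 S22) (√(1-ρ²) + (π/2 + arcsin ρ) ρ)`.
The joint Gaussianity is encoded by requiring every linear combination
`a X + b Y` to be a centred Gaussian with the appropriate variance. -/
theorem stmt_3 {Ω : Type*} [MeasurableSpace Ω] (P : Measure Ω) [IsProbabilityMeasure P]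
    (X Y : Ω → ℝ) (S11 S12 S22 : ℝ) (h11 : 0 < S11) (h22 : 0 < S22)
    (hcorr : |S12 / Real.sqrt (S11 * S22)| ≤ 1)
    (hgauss : ∀ a b : ℝ,
      Measure.map (fun ω => a * X ω + b * Y ω) P =
        gaussianReal 0 (Real.toNNReal (a ^ 2 * S11 + 2 * a * b * S12 + b ^ 2 * S22))) :
    ∫ ω, max 0 (X ω) * max 0 (Y ω) ∂P =
      (1 / (2 * Real.pi)) * Real.sqrt (S11 * S22) *
        (Real.sqrt (1 - (S12 / Real.sqrt (S11 * S22)) ^ 2) +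
          (Real.pi / 2 + Real.arcsin (S12 / Real.sqrt (S11 * S22))) *
            (S12 / Real.sqrt (S11 * S22))) := by
  have hs := Real.sqrt_pos.2 h11
  have ht := Real.sqrt_pos.2 h22
  have hst : √(S11 * S22) = √S11 * √S22 := Real.sqrt_mul h11.le _
  set ρ := S12 / √(S11 * S22) with hρ
  have hS12 : S12 = ρ * (√S11 * √S22) := by
    rw [hρ, hst]
    field_simp
  set θ := Real.arcsin ρ with hθ
  have hsin : Real.sin θ = ρ := Real.sin_arcsin (abs_le.1 hcorr).1 (abs_le.1 hcorr).2
  have hcos : Real.cos θ = √(1 - ρ ^ 2) := Real.cos_arcsin ρ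
  have haem (a b : ℝ) : AEMeasurable (fun ω => a * X ω + b * Y ω) P :=
    AEMeasurable.of_map_ne_zero (by rw [hgauss]; exact IsProbabilityMeasure.ne_zero _)
  have hX : AEMeasurable X P := by simpa using haem 1 0
  have hY : AEMeasurable Y P := by simpa using haem 0 1
  have hXY : AEMeasurable (fun ω => (X ω, Y ω)) P := hX.prodMk hY
  let T : ℝ × ℝ → ℝ × ℝ :=
    fun p => (√S11 * p.1, √S22 * (Real.sin θ * p.1 + Real.cos θ * p.2))
  have hT : Measurable T := by fun_prop
  have hlaw : P.map (fun ω => (X ω, Y ω)) =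
      ((gaussianReal 0 1).prod (gaussianReal 0 1)).map T := by
    have := Measure.isProbabilityMeasure_map (μ := P) hXY
    refine ext_of_map_linear_combination fun a b => ?_
    rw [AEMeasurable.map_map_of_aemeasurable (by fun_prop) hXY,
      Measure.map_map (by fun_prop) hT]
    have hlin : (fun p : ℝ × ℝ => a * p.1 + b * p.2) ∘ T = fun p =>
        (a * √S11 + b * √S22 * Real.sin θ) * p.1 + (b * √S22 * Real.cos θ) * p.2 := by
      funext p
      simp only [T, Function.comp_apply]
      ring
    rw [hlin, map_linear_combination_stdGaussian_prod]
    refine (hgauss a b).trans ?_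
    congr 2
    rw [hS12, ← hsin]
    have h₁ := Real.sq_sqrt h11.le
    have h₂ := Real.sq_sqrt h22.le
    have h₃ := Real.cos_sq' θ
    linear_combination (-a ^ 2) * h₁ - b ^ 2 * h₂ - b ^ 2 * √S22 ^ 2 * h₃
  have hmeas : Measurable fun q : ℝ × ℝ => max 0 q.1 * max 0 q.2 := by fun_prop
  have hmax {c : ℝ} (hc : 0 < c) (x : ℝ) : max 0 (c * x) = c * max 0 x := by
    rw [mul_max_of_nonneg _ _ hc.le, mul_zero]
  calc ∫ ω, max 0 (X ω) * max 0 (Y ω) ∂P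
      = ∫ q, max 0 q.1 * max 0 q.2 ∂(P.map fun ω => (X ω, Y ω)) :=
        (integral_map hXY hmeas.aestronglyMeasurable).symm
    _ = ∫ p, √S11 * √S22 * (max 0 p.1 * max 0 (Real.sin θ * p.1 + Real.cos θ * p.2))
          ∂((gaussianReal 0 1).prod (gaussianReal 0 1)) := by
        rw [hlaw, integral_map hT.aemeasurable hmeas.aestronglyMeasurable]
        refine integral_congr_ae (.of_forall fun p => ?_)
        simp only [T, hmax hs, hmax ht]
        ring
    _ = _ := by
        rw [integral_const_mul, integral_max_mul_max_stdGaussian_prod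
          (Real.neg_pi_div_two_le_arcsin ρ) (Real.arcsin_le_pi_div_two ρ), hsin, hcos, hst]
        ring
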